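/- Let M_1 = (S, 𝓘_1, ≻_1) and M_2 = (S, 𝓘_2, ≻_2) be ordered matroids on the same finite ground set S, each given as a direct sum of matroids on disjoint parts of S. Then for any common independent set I ∈ 𝓘_1 ∩ 𝓘_2 the following implications hold: if I is super popular then I is popular; if I is popular then I is defendable; and if I is defendable then I is weakly defendable. -/

import Mathlib

open Finset
open scoped Classical

noncomputable section

/-- A matroid on the finite ground set `α`, given by its independence predicate on finsets. -/
structure FinMatroid (α : Type*) [DecidableEq α] where
  Indep : Finset α → Prop
  exists_indep : ∃ I, Indep I
  indep_subset : ∀ ⦃I J : Finset α⦄, I ⊆ J → Indep J → Indep I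
  indep_exchange : ∀ ⦃I J : Finset α⦄, Indep I → Indep J → I.card < J.card →
    ∃ v ∈ J \ I, Indep (insert v I)

/-- `N` is a pairing between `I \ J` and `J \ I`: a set of pairwise disjoint pairs `(u, v)`
with `u ∈ I \ J` and `v ∈ J \ I`. -/
def IsPairing {α : Type*} [DecidableEq α] (I J : Finset α) (N : Finset (α × α)) : Prop :=
  (∀ p ∈ N, p.1 ∈ I \ J ∧ p.2 ∈ J \ I) ∧
  (∀ p ∈ N, ∀ q ∈ N, p.1 = q.1 → p = q) ∧
  (∀ p ∈ N, ∀ q ∈ N, p.2 = q.2 → p = q)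

/-- `N` is a weakly feasible pairing for `(I, J)`:
(1) `I - u + v` is independent for every `(u, v) ∈ N`, and
(2) every `v ∈ J \ I` with `I + v` dependent is covered by `N`. -/
def WeaklyFeasible {α : Type*} [DecidableEq α] (M : FinMatroid α) (I J : Finset α)
    (N : Finset (α × α)) : Prop :=
  IsPairing I J N ∧
  (∀ p ∈ N, M.Indep (insert p.2 (I.erase p.1))) ∧
  (∀ v ∈ J \ I, ¬ M.Indep (insert v I) → ∃ p ∈ N, p.2 = v)

/-- `N` is a feasible pairing for `(I, J)` with respect to the direct-sum partition
`part : α → ι`: in addition to weak feasibility,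
(3) every `u ∈ I \ J` with `J + u` dependent is covered by `N`,
(4) both entries of each pair lie in the same part, and
(5) for every part `j`, the number of pairs inside part `j` is
`min (|S_j ∩ (I \ J)|, |S_j ∩ (J \ I)|)`. -/
def Feasible {α ι : Type*} [DecidableEq α] (M : FinMatroid α) (part : α → ι)
    (I J : Finset α) (N : Finset (α × α)) : Prop :=
  WeaklyFeasible M I J N ∧
  (∀ u ∈ I \ J, ¬ M.Indep (insert u J) → ∃ p ∈ N, p.1 = u) ∧
  (∀ p ∈ N, part p.1 = part p.2) ∧
  (∀ j : ι, (N.filter fun p => part p.1 = j).card =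
    min (((I \ J).filter fun a => part a = j).card) (((J \ I).filter fun a => part a = j).card))

/-- `vote(I, J, N) = |{(u,v) ∈ N : u ≻ v}| - |{(u,v) ∈ N : v ≻ u}| + |I| - |J|`,
where `gt a b` means `a ≻ b`. -/
def voteN {α : Type*} (gt : α → α → Prop) (I J : Finset α) (N : Finset (α × α)) : ℤ :=
  ((N.filter fun p => gt p.1 p.2).card : ℤ) - ((N.filter fun p => gt p.2 p.1).card : ℤ)
    + (I.card : ℤ) - (J.card : ℤ)

/-- `vote•(I, J)`: the minimum of `vote(I, J, N)` over weakly feasible pairings `N` for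
`(I, J)`. -/
def voteB {α : Type*} [DecidableEq α] (M : FinMatroid α) (gt : α → α → Prop)
    (I J : Finset α) : ℤ :=
  sInf {z : ℤ | ∃ N : Finset (α × α), WeaklyFeasible M I J N ∧ z = voteN gt I J N}

/-- `vote(I, J)`: the minimum of `vote(I, J, N)` over feasible pairings `N` for `(I, J)`. -/
def voteF {α ι : Type*} [DecidableEq α] (M : FinMatroid α) (gt : α → α → Prop)
    (part : α → ι) (I J : Finset α) : ℤ :=
  sInf {z : ℤ | ∃ N : Finset (α × α), Feasible M part I J N ∧ z = voteN gt I J N}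

namespace FinMatroid

variable {α ι : Type*} [DecidableEq α]

/-- An independent set can be enlarged inside `I ∪ J` to the size of a larger independent set. -/
lemma exists_augment (M : FinMatroid α) {I J : Finset α} (hI : M.Indep I) (hJ : M.Indep J)
    (hcard : I.card ≤ J.card) :
    ∃ X, I ⊆ X ∧ X ⊆ I ∪ J ∧ M.Indep X ∧ X.card = J.card := by
  induction hk : J.card - I.card generalizing I with
  | zero => exact ⟨I, Subset.rfl, subset_union_left, hI, by omega⟩
  | succ k ih =>
    obtain ⟨v, hv, hvI⟩ := M.indep_exchange hI hJ (by omega)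
    rw [mem_sdiff] at hv
    have hc : (insert v I).card = I.card + 1 := card_insert_of_notMem hv.2
    obtain ⟨X, hIX, hXJ, hX, hXc⟩ := ih hvI (by omega) (by omega)
    refine ⟨X, (subset_insert v I).trans hIX, fun x hx => ?_, hX, hXc⟩
    have := hXJ hx
    simp only [mem_union, mem_insert] at this ⊢
    rcases this with (rfl | h) | h
    · exact Or.inr hv.1
    · exact Or.inl h
    · exact Or.inr h

/-- For independent sets of equal size, every `u ∈ A \ B` can replace some `v ∈ B \ A` in `B`. -/
lemma exists_swap (M : FinMatroid α) {A B : Finset α} (hA : M.Indep A) (hB : M.Indep B)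
    (hcard : A.card = B.card) {u : α} (hu : u ∈ A \ B) :
    ∃ v ∈ B \ A, M.Indep (insert u (B.erase v)) := by
  rw [mem_sdiff] at hu
  have hsub : insert u (A ∩ B) ⊆ A := insert_subset hu.1 inter_subset_left
  obtain ⟨X, hX₁, hX₂, hX, hXc⟩ := M.exists_augment (M.indep_subset hsub hA) hB
    (hcard ▸ card_le_card hsub)
  have hc : (insert u B).card = B.card + 1 := card_insert_of_notMem hu.2
  obtain ⟨v, hv, hvX⟩ : ∃ v ∈ insert u B, v ∉ X := exists_mem_notMem_of_card_lt_card (by omega)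
  have hvu : v ≠ u := fun h => hvX (hX₁ (by simp [h]))
  have hvB : v ∈ B := (mem_insert.1 hv).resolve_left hvu
  have hvA : v ∉ A := fun h => hvX (hX₁ (by simp [h, hvB]))
  have hXsub : X ⊆ insert u (B.erase v) := by
    intro x hx
    have hxv : x ≠ v := fun h => hvX (h ▸ hx)
    have := hX₂ hx
    simp only [mem_union, mem_insert, mem_inter, mem_erase] at this ⊢
    tauto
  have hXeq : X = insert u (B.erase v) := by
    refine eq_of_subset_of_card_le hXsub ?_
    have h1 := card_insert_le u (B.erase v)
    have h2 := card_erase_add_one hvB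
    omega
  exact ⟨v, mem_sdiff.2 ⟨hvB, hvA⟩, hXeq ▸ hX⟩

/-- Suppose `A`, `B` are independent of equal size, and `T`, `S` are orderings in which exchanges
into `A` increase `T` and exchanges into `B` increase `S`. Then `A \ B` and `B \ A` can be matched
along pairs that increase `T` and decrease `S`; in particular, a function that grows by at least
one along all such pairs has a correspondingly larger sum over `B \ A`. -/
lemma sum_add_card_le_of_exchange_monotone {κ₁ κ₂ : Type*} [LinearOrder κ₁] [LinearOrder κ₂]
    (M : FinMatroid α) (T : α → κ₁) (S : α → κ₂) (f : α → ℤ)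
    (hf : ∀ u v, T u < T v → S v < S u → f u + 1 ≤ f v)
    {A B : Finset α} (hA : M.Indep A) (hB : M.Indep B) (hcard : A.card = B.card)
    (hT : ∀ u ∈ A \ B, ∀ v ∈ B \ A, M.Indep (insert v (A.erase u)) → T u < T v)
    (hS : ∀ u ∈ A \ B, ∀ v ∈ B \ A, M.Indep (insert u (B.erase v)) → S v < S u) :
    ∑ u ∈ A \ B, f u + ((A \ B).card : ℤ) ≤ ∑ v ∈ B \ A, f v := by
  induction hk : (A \ B).card generalizing B with
  | zero =>
    have h := card_sdiff_add_card A B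
    have h' := card_sdiff_add_card B A
    rw [union_comm B A] at h'
    have h1 : A \ B = ∅ := card_eq_zero.1 hk
    have h2 : B \ A = ∅ := card_eq_zero.1 (by omega)
    simp [h1, h2]
  | succ k ih =>
    have hne : (A \ B).Nonempty := card_pos.1 (by omega)
    obtain ⟨u, hu, hmin⟩ := exists_min_image (A \ B) T hne
    obtain ⟨v₀, hv₀, hv₀i⟩ := M.exists_swap hA hB hcard hu
    obtain ⟨v, hv, hmax⟩ := exists_max_image
      ((B \ A).filter fun v => M.Indep (insert u (B.erase v))) S
      ⟨v₀, mem_filter.2 ⟨hv₀, hv₀i⟩⟩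
    obtain ⟨hvBA, hvi⟩ := mem_filter.1 hv
    obtain ⟨u₀, hu₀, hu₀i⟩ := M.exists_swap hB hA hcard.symm hvBA
    have hTuv : T u < T v := (hmin u₀ hu₀).trans_lt (hT u₀ hu₀ v hvBA hu₀i)
    have hSvu : S v < S u := hS u hu v hvBA hvi
    have hu' := mem_sdiff.1 hu
    have hv' := mem_sdiff.1 hvBA
    have huv : u ≠ v := fun h => hu'.2 (h ▸ hv'.1)
    have hAB : A \ insert u (B.erase v) = (A \ B).erase u := by
      ext x
      simp only [mem_sdiff, mem_insert, mem_erase]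
      have : x = v → x ∉ A := fun h => h ▸ hv'.2
      tauto
    have hBA : insert u (B.erase v) \ A = (B \ A).erase v := by
      ext x
      simp only [mem_sdiff, mem_insert, mem_erase]
      have : x = u → x ∈ A := fun h => h ▸ hu'.1
      tauto
    have hcB : (insert u (B.erase v)).card = B.card := by
      rw [card_insert_of_notMem (fun h => hu'.2 (mem_of_mem_erase h)), card_erase_add_one hv'.1]
    have key := ih hvi (hcard.trans hcB.symm) ?_ ?_ ?_
    · rw [hAB, hBA] at key
      have h1 := add_sum_erase _ f hu
      have h2 := add_sum_erase _ f hvBA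
      have h3 := hf u v hTuv hSvu
      push_cast
      linarith
    · intro u₁ hu₁ v₁ hv₁ h
      rw [hAB] at hu₁
      rw [hBA] at hv₁
      exact hT u₁ (mem_of_mem_erase hu₁) v₁ (mem_of_mem_erase hv₁) h
    · intro u₁ hu₁ v₁ hv₁ h
      rw [hAB, mem_erase] at hu₁
      rw [hBA, mem_erase] at hv₁
      have hu₁' := mem_sdiff.1 hu₁.2
      have hv₁' := mem_sdiff.1 hv₁.2
      by_cases hd : M.Indep (insert u₁ (B.erase v₁))
      · exact hS u₁ hu₁.2 v₁ hv₁.2 hd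
      have hcE : ((B.erase v).erase v₁).card + 2 = B.card := by
        have h1 := card_erase_add_one hv'.1
        have h2 := card_erase_add_one (mem_erase.2 ⟨hv₁.1, hv₁'.1⟩)
        omega
      have hsub : insert u₁ ((B.erase v).erase v₁) ⊆
          insert u₁ ((insert u (B.erase v)).erase v₁) := by
        refine insert_subset_insert _ (erase_subset_erase _ (subset_insert _ _))
      have hcu₁ : (insert u₁ ((B.erase v).erase v₁)).card < B.card := by
        have := card_insert_le u₁ ((B.erase v).erase v₁)
        omega
      have hvu₁ : M.Indep (insert u₁ (B.erase v)) := by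
        obtain ⟨w, hw, hwi⟩ := M.indep_exchange (M.indep_subset hsub h) hB hcu₁
        simp only [mem_sdiff, mem_insert, mem_erase, not_or, not_and] at hw
        by_cases hwv : w = v
        · refine absurd (M.indep_subset ?_ hwi) hd
          intro x
          simp only [mem_insert, mem_erase]
          subst hwv
          tauto
        · have hwv₁ : w = v₁ := by tauto
          refine M.indep_subset ?_ hwi
          intro x
          simp only [mem_insert, mem_erase]
          subst hwv₁
          tauto
      have hv₁u : M.Indep (insert u (B.erase v₁)) := by
        have hlt : (B.erase v₁).card <
            (insert u₁ ((insert u (B.erase v)).erase v₁)).card := by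
          have h1 := card_erase_add_one hv₁'.1
          have h2 := card_erase_add_one
            (mem_insert_of_mem (b := u) (mem_erase.2 ⟨hv₁.1, hv₁'.1⟩))
          rw [card_insert_of_notMem]
          · omega
          · simp only [mem_insert, mem_erase]
            tauto
        obtain ⟨w, hw, hwi⟩ := M.indep_exchange
          (M.indep_subset (erase_subset v₁ B) hB) h hlt
        simp only [mem_sdiff, mem_insert, mem_erase] at hw
        by_cases hwu : w = u₁
        · exact absurd (hwu ▸ hwi) hd
        · have : w = u := by tauto
          exact this ▸ hwi
      exact (hmax v₁ (mem_filter.2 ⟨hv₁.2, hv₁u⟩)).trans_lt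
        (hS u₁ hu₁.2 v hvBA hvu₁)
    · rw [hAB, card_erase_of_mem hu]
      omega

/-- The truncation of a direct sum of matroids, with rank bound `n j` on the part `j`. -/
def truncParts (M : FinMatroid α) (part : α → ι)
    (hdsum : ∀ X : Finset α, M.Indep X ↔ ∀ j : ι, M.Indep (X.filter fun a => part a = j))
    (n : ι → ℕ) : FinMatroid α where
  Indep X := M.Indep X ∧ ∀ j, (X.filter fun a => part a = j).card ≤ n j
  exists_indep := by
    obtain ⟨I, hI⟩ := M.exists_indep
    exact ⟨∅, M.indep_subset (empty_subset I) hI, by simp⟩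
  indep_subset I J hIJ hJ :=
    ⟨M.indep_subset hIJ hJ.1, fun j => (card_le_card (filter_subset_filter _ hIJ)).trans (hJ.2 j)⟩
  indep_exchange I J hI hJ hlt := by
    obtain ⟨j, hj⟩ : ∃ j, (I.filter fun a => part a = j).card <
        (J.filter fun a => part a = j).card := by
      by_contra! hcon
      have h1 : ∀ X ⊆ I ∪ J, X.card =
          ∑ j ∈ (I ∪ J).image part, (X.filter fun a => part a = j).card := fun X hX =>
        card_eq_sum_card_fiberwise fun x hx => mem_image_of_mem part (hX hx)
      have h2 := sum_le_sum fun j (_ : j ∈ (I ∪ J).image part) => hcon j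
      rw [← h1 _ subset_union_left, ← h1 _ subset_union_right] at h2
      omega
    obtain ⟨v, hv, hvi⟩ := M.indep_exchange ((hdsum I).1 hI.1 j) ((hdsum J).1 hJ.1 j) hj
    simp only [mem_sdiff, mem_filter, not_and] at hv
    obtain ⟨⟨hvJ, hvj⟩, hvI⟩ := hv
    have hvI : v ∉ I := fun h => hvI h hvj
    refine ⟨v, mem_sdiff.2 ⟨hvJ, hvI⟩, (hdsum _).2 fun i => ?_, fun i => ?_⟩
    · rw [filter_insert]
      split_ifs with h
      · rw [← h, hvj]
        exact hvi
      · exact (hdsum I).1 hI.1 i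
    · rw [filter_insert]
      split_ifs with h
      · have := card_insert_le v (I.filter fun a => part a = i)
        have h3 := hJ.2 i
        rw [← h, hvj] at *
        omega
      · exact hI.2 i

/-- An independent set of the direct sum extends inside `I ∪ J` so that every part has the larger
of the two sizes. -/
lemma exists_augment_parts (M : FinMatroid α) (part : α → ι)
    (hdsum : ∀ X : Finset α, M.Indep X ↔ ∀ j : ι, M.Indep (X.filter fun a => part a = j))
    {I J : Finset α} (hI : M.Indep I) (hJ : M.Indep J) :
    ∃ X, I ⊆ X ∧ X ⊆ I ∪ J ∧ M.Indep X ∧ ∀ j, (X.filter fun a => part a = j).card =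
      max (I.filter fun a => part a = j).card (J.filter fun a => part a = j).card := by
  set n : ι → ℕ := fun j =>
    max (I.filter fun a => part a = j).card (J.filter fun a => part a = j).card
  set M' := M.truncParts part hdsum n
  have hI' : M'.Indep I := ⟨hI, fun j => le_max_left _ _⟩
  obtain ⟨X, hX, hmax⟩ := exists_max_image
    ((I ∪ J).powerset.filter fun X => I ⊆ X ∧ M'.Indep X) card
    ⟨I, mem_filter.2 ⟨mem_powerset.2 subset_union_left, Subset.rfl, hI'⟩⟩
  simp only [mem_filter, mem_powerset] at hX hmax
  refine ⟨X, hX.2.1, hX.1, hX.2.2.1, fun j => le_antisymm (hX.2.2.2 j) ?_⟩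
  by_contra! hlt
  have hIX := card_le_card (filter_subset_filter (fun a => part a = j) hX.2.1)
  obtain ⟨v, hv, hvi⟩ := M.indep_exchange ((hdsum X).1 hX.2.2.1 j) ((hdsum J).1 hJ j)
    (by rw [lt_max_iff] at hlt; omega)
  simp only [mem_sdiff, mem_filter, not_and] at hv
  obtain ⟨⟨hvJ, hvj⟩, hvX⟩ := hv
  have hvX : v ∉ X := fun h => hvX h hvj
  have hle := hmax (insert v X) ⟨insert_subset (mem_union_right _ hvJ) hX.1,
    hX.2.1.trans (subset_insert _ _), (hdsum _).2 fun i => ?_, fun i => ?_⟩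
  · rw [card_insert_of_notMem hvX] at hle
    omega
  · rw [filter_insert]
    split_ifs with h
    · rw [← h, hvj]
      exact hvi
    · exact (hdsum X).1 hX.2.2.1 i
  · rw [filter_insert]
    split_ifs with h
    · obtain rfl : j = i := hvj.symm.trans h
      exact (card_insert_le _ _).trans hlt
    · exact hX.2.2.2 i

end FinMatroid

/-- Integral duality for weighted perfect matchings: if the dual objective is bounded below, some
feasible dual solution `t` has a perfect matching of tight edges. -/
lemma exists_tight_matching {α : Type*} (U V : Finset α)
    (hUV : Disjoint U V) (E : α → α → Prop) (c : α → α → ℤ) (L : ℤ)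
    (hfeas : ∃ t : α → ℤ, ∀ u ∈ U, ∀ v ∈ V, E u v → c u v ≤ t v - t u)
    (hbdd : ∀ t : α → ℤ, (∀ u ∈ U, ∀ v ∈ V, E u v → c u v ≤ t v - t u) →
      L ≤ ∑ v ∈ V, t v - ∑ u ∈ U, t u) :
    ∃ (t : α → ℤ) (g : α → α), (∀ u ∈ U, ∀ v ∈ V, E u v → c u v ≤ t v - t u) ∧
      Set.InjOn g U ∧ ∀ u ∈ U, g u ∈ V ∧ E u (g u) ∧ c u (g u) = t (g u) - t u := by
  obtain ⟨t₀, ht₀⟩ := hfeas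
  obtain ⟨z, ⟨t, ht, rfl⟩, hmin⟩ := Int.exists_least_of_bdd
    (P := fun z => ∃ t : α → ℤ, (∀ u ∈ U, ∀ v ∈ V, E u v → c u v ≤ t v - t u) ∧
      z = ∑ v ∈ V, t v - ∑ u ∈ U, t u)
    ⟨L, by rintro _ ⟨t, ht, rfl⟩; exact hbdd t ht⟩ ⟨_, t₀, ht₀, rfl⟩
  let nb : U → Finset α := fun u => V.filter fun v => E u v ∧ c u v = t v - t u
  have hall : ∀ W : Finset U, W.card ≤ (W.biUnion nb).card := by
    intro W
    by_contra! hlt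
    set W' : Finset α := W.map (Function.Embedding.subtype _)
    set Q := W.biUnion nb
    have hW'U : W' ⊆ U := by
      intro x hx
      simp only [W', mem_map] at hx
      obtain ⟨y, -, rfl⟩ := hx
      exact y.2
    have hQV : Q ⊆ V := biUnion_subset.2 fun u _ => filter_subset _ _
    have hW'c : W'.card = W.card := card_map _
    let t' : α → ℤ := fun x => t x + if x ∈ W' ∪ Q then 1 else 0
    have hU : ∑ u ∈ U, t' u = ∑ u ∈ U, t u + W'.card := by
      rw [sum_add_distrib, ← sum_filter, sum_const, nsmul_eq_mul, mul_one]
      congr 3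
      ext x
      simp only [mem_filter, mem_union]
      refine ⟨fun h => h.2.resolve_right fun hq => disjoint_left.1 hUV h.1 (hQV hq),
        fun h => ⟨hW'U h, Or.inl h⟩⟩
    have hV : ∑ v ∈ V, t' v = ∑ v ∈ V, t v + Q.card := by
      rw [sum_add_distrib, ← sum_filter, sum_const, nsmul_eq_mul, mul_one]
      congr 3
      ext x
      simp only [mem_filter, mem_union]
      refine ⟨fun h => h.2.resolve_left fun hq => disjoint_left.1 hUV (hW'U hq) h.1,
        fun h => ⟨hQV h, Or.inr h⟩⟩
    have hle := hmin _ ⟨t', fun u hu v hv hE => ?_, rfl⟩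
    · rw [hU, hV] at hle
      omega
    · have h0 := ht u hu v hv hE
      have huQ : u ∉ Q := fun h => disjoint_left.1 hUV hu (hQV h)
      have hvW : v ∉ W' := fun h => disjoint_left.1 hUV (hW'U h) hv
      simp only [t', mem_union, huQ, hvW, or_false, false_or]
      by_cases huW : u ∈ W'
      · by_cases hvQ : v ∈ Q
        · simp only [huW, hvQ, if_true]
          omega
        · have hne : c u v ≠ t v - t u := by
            intro heq
            apply hvQ
            simp only [W', mem_map] at huW
            obtain ⟨y, hy, rfl⟩ := huW
            exact mem_biUnion.2 ⟨y, hy, mem_filter.2 ⟨hv, hE, heq⟩⟩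
          simp only [huW, hvQ, if_true, if_false]
          omega
      · simp only [huW, if_false]
        split_ifs <;> omega
  obtain ⟨g, hg, hgm⟩ := (all_card_le_biUnion_card_iff_exists_injective nb).1 hall
  refine ⟨t, fun x => if hx : x ∈ U then g ⟨x, hx⟩ else x, ht, ?_, ?_⟩
  · intro x hx y hy hxy
    simp only [mem_coe] at hx hy
    simp only [hx, hy, dif_pos] at hxy
    simpa using hg hxy
  · intro u hu
    simp only [hu, dif_pos]
    have := hgm ⟨u, hu⟩
    simpa only [nb, mem_filter] using this

lemma image_eq_of_injOn_of_card_eq {α : Type*} [DecidableEq α] {U V : Finset α} {g : α → α}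
    (hcard : U.card = V.card) (hg : Set.InjOn g U) (hgV : ∀ u ∈ U, g u ∈ V) : U.image g = V :=
  eq_of_subset_of_card_le (image_subset_iff.2 hgV) (by rw [card_image_of_injOn hg, hcard])

/-- Weak duality between the potentials for exchanges into `A` and those for exchanges into `B`. -/
lemma FinMatroid.card_sdiff_le_of_potentials {α : Type*} [DecidableEq α] [Fintype α]
    (M : FinMatroid α) (gt : α → α → Prop) (hgt : IsStrictTotalOrder α gt)
    {A B : Finset α} (hA : M.Indep A) (hB : M.Indep B) (hcard : A.card = B.card) (t s : α → ℤ)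
    (ht : ∀ u ∈ A \ B, ∀ v ∈ B \ A, M.Indep (insert v (A.erase u)) →
      (if gt v u then 1 else 0) ≤ t v - t u)
    (hs : ∀ v ∈ B \ A, ∀ u ∈ A \ B, M.Indep (insert u (B.erase v)) →
      (if gt u v then 1 else 0) ≤ s u - s v) :
    ((A \ B).card : ℤ) ≤ (∑ v ∈ B \ A, t v - ∑ u ∈ A \ B, t u) +
      (∑ u ∈ A \ B, s u - ∑ v ∈ B \ A, s v) := by
  let pos : α → ℕ := fun a => (univ.filter fun x => gt x a).card
  have hpos : ∀ a b, gt a b → pos a < pos b := by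
    intro a b hab
    refine card_lt_card ⟨fun x hx => ?_, fun hsub => ?_⟩
    · simp only [mem_filter, mem_univ, true_and] at hx ⊢
      exact _root_.trans hx hab
    · have : a ∈ univ.filter fun x => gt x a := hsub (by simp [hab])
      exact irrefl a (mem_filter.1 this).2
  have hlex : ∀ (p : α → ℤ) (x y : α), x ≠ y → (if gt y x then 1 else 0) ≤ p y - p x →
      toLex (p x, pos x) < toLex (p y, pos y) := by
    intro p x y hxy h
    rw [Prod.Lex.toLex_lt_toLex]
    rcases trichotomous_of gt x y with hg | hg | hg
    · have := hpos x y hg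
      split_ifs at h <;> simp only <;> omega
    · exact absurd hg hxy
    · rw [if_pos hg] at h
      simp only
      omega
  have hne : ∀ u ∈ A \ B, ∀ v ∈ B \ A, u ≠ v := fun u hu v hv huv =>
    (mem_sdiff.1 hu).2 (huv ▸ (mem_sdiff.1 hv).1)
  have key := M.sum_add_card_le_of_exchange_monotone (fun x => toLex (t x, pos x))
    (fun x => toLex (s x, pos x)) (fun x => t x - s x) ?_ hA hB hcard
    (fun u hu v hv h => hlex t u v (hne u hu v hv) (ht u hu v hv h))
    (fun u hu v hv h => hlex s v u (hne u hu v hv).symm (hs v hv u hu h))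
  · simp only [sum_sub_distrib] at key
    linarith
  · intro u v h1 h2
    rw [Prod.Lex.toLex_lt_toLex] at h1 h2
    simp only at h1 h2
    omega

/-- A perfect exchange matching between augmentations of `I` and `J` is feasible for `(I, J)`. -/
lemma feasible_of_augmentation {α ι : Type*} [DecidableEq α] (M : FinMatroid α) (part : α → ι)
    {I J A B : Finset α} (hIA : I ⊆ A) (hAIJ : A ⊆ I ∪ J) (hA : M.Indep A)
    (hJB : J ⊆ B) (hBIJ : B ⊆ I ∪ J) (hB : M.Indep B)
    (hBn : ∀ j, (B.filter fun a => part a = j).card =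
      max (I.filter fun a => part a = j).card (J.filter fun a => part a = j).card)
    (g : α → α) (hg : Set.InjOn g ↑(A \ B)) (hgBA : (A \ B).image g = B \ A)
    (hgi : ∀ u ∈ A \ B, M.Indep (insert (g u) (A.erase u)))
    (hgp : ∀ u ∈ A \ B, part u = part (g u)) :
    Feasible M part I J ((A \ B).image fun u => (u, g u)) := by
  have hAB : A \ B ⊆ I \ J := by
    intro x hx
    rw [mem_sdiff] at hx ⊢
    have hxJ : x ∉ J := fun h => hx.2 (hJB h)
    exact ⟨(mem_union.1 (hAIJ hx.1)).resolve_right hxJ, hxJ⟩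
  have hBA : B \ A ⊆ J \ I := by
    intro x hx
    rw [mem_sdiff] at hx ⊢
    have hxI : x ∉ I := fun h => hx.2 (hIA h)
    exact ⟨(mem_union.1 (hBIJ hx.1)).resolve_left hxI, hxI⟩
  have hgm : ∀ u ∈ A \ B, g u ∈ B \ A := fun u hu => hgBA ▸ mem_image_of_mem g hu
  refine ⟨⟨⟨?_, ?_, ?_⟩, ?_, ?_⟩, ?_, ?_, fun j => ?_⟩
  · simp only [forall_mem_image]
    exact fun u hu => ⟨hAB hu, hBA (hgm u hu)⟩
  · simp only [forall_mem_image]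
    intro u _ w _ h
    rw [h]
  · simp only [forall_mem_image]
    intro u hu w hw h
    rw [hg hu hw h]
  · simp only [forall_mem_image]
    exact fun u hu => M.indep_subset (insert_subset_insert _ (erase_subset_erase _ hIA)) (hgi u hu)
  · intro v hv hdep
    rw [mem_sdiff] at hv
    have hvA : v ∉ A := fun h => hdep (M.indep_subset (insert_subset h hIA) hA)
    have hvBA : v ∈ (A \ B).image g := hgBA ▸ mem_sdiff.2 ⟨hJB hv.1, hvA⟩
    obtain ⟨u, hu, rfl⟩ := mem_image.1 hvBA
    exact ⟨_, mem_image_of_mem _ hu, rfl⟩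
  · intro u hu hdep
    rw [mem_sdiff] at hu
    have huB : u ∉ B := fun h => hdep (M.indep_subset (insert_subset h hJB) hB)
    exact ⟨_, mem_image_of_mem _ (mem_sdiff.2 ⟨hIA hu.1, huB⟩), rfl⟩
  · simpa only [forall_mem_image] using hgp
  · have hN : (((A \ B).image fun u => (u, g u)).filter fun p => part p.1 = j).card =
        ((A \ B).filter fun a => part a = j).card := by
      rw [filter_image, card_image_of_injective _ fun x y h => (Prod.ext_iff.1 h).1]
    have hsd : ∀ X Y : Finset α, ((X \ Y).filter fun a => part a = j).card +
        (Y.filter fun a => part a = j).card = ((X ∪ Y).filter fun a => part a = j).card := by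
      intro X Y
      rw [filter_union, ← card_sdiff_add_card]
      congr 2
      ext x
      simp only [mem_filter, mem_sdiff]
      tauto
    have h1 := hsd I J
    have h2 := hsd J I
    rw [union_comm J I] at h2
    have h3 := hsd A B
    have hU : A ∪ B = I ∪ J :=
      (union_subset hAIJ hBIJ).antisymm (union_subset_union hIA hJB)
    rw [hU, hBn j] at h3
    rw [hN]
    omega

/-- Vote of the pairing given by a matching function. -/
lemma voteN_image {α : Type*} [DecidableEq α] (gt : α → α → Prop)
    (hgt : IsStrictTotalOrder α gt) (I J U : Finset α) (g : α → α) (hne : ∀ u ∈ U, u ≠ g u) :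
    voteN gt I J (U.image fun u => (u, g u)) =
      U.card - 2 * ∑ u ∈ U, (if gt (g u) u then (1 : ℤ) else 0) + I.card - J.card := by
  have hinj : Function.Injective fun u : α => (u, g u) := fun x y h => (Prod.ext_iff.1 h).1
  have h1 : (U.filter fun u => gt u (g u)) = U.filter fun u => ¬ gt (g u) u := by
    refine filter_congr fun u hu => ⟨fun h h' => irrefl u (_root_.trans h h'), fun h => ?_⟩
    rcases trichotomous_of gt u (g u) with hg | hg | hg
    · exact hg
    · exact absurd hg (hne u hu)
    · exact absurd hg h
  have h2 := card_filter_add_card_filter_not (s := U) fun u => gt (g u) u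
  rw [voteN, filter_image, filter_image, card_image_of_injective _ hinj,
    card_image_of_injective _ hinj, sum_boole, h1, ← h2]
  push_cast
  ring

/-- There are feasible pairings for `(I, J)` and `(J, I)` whose votes add up to at most zero. -/
lemma exists_feasible_pair {α ι : Type*} [DecidableEq α] [Fintype α] (M : FinMatroid α)
    (gt : α → α → Prop) (hgt : IsStrictTotalOrder α gt) (part : α → ι)
    (hdsum : ∀ X : Finset α, M.Indep X ↔ ∀ j : ι, M.Indep (X.filter fun a => part a = j))
    {I J : Finset α} (hI : M.Indep I) (hJ : M.Indep J) :
    ∃ N N', Feasible M part I J N ∧ Feasible M part J I N' ∧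
      voteN gt I J N + voteN gt J I N' ≤ 0 := by
  obtain ⟨A, hIA, hAIJ, hA, hAn⟩ := M.exists_augment_parts part hdsum hI hJ
  obtain ⟨B, hJB, hBJI, hB, hBn⟩ := M.exists_augment_parts part hdsum hJ hI
  have hBn' : ∀ j, (B.filter fun a => part a = j).card =
      max (I.filter fun a => part a = j).card (J.filter fun a => part a = j).card :=
    fun j => (hBn j).trans (max_comm _ _)
  have hAn' : ∀ j, (A.filter fun a => part a = j).card =
      max (J.filter fun a => part a = j).card (I.filter fun a => part a = j).card :=
    fun j => (hAn j).trans (max_comm _ _)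
  have hparts : ∀ j, (A.filter fun a => part a = j).card = (B.filter fun a => part a = j).card :=
    fun j => (hAn j).trans (hBn' j).symm
  set M' := M.truncParts part hdsum fun j => (A.filter fun a => part a = j).card
  have hA' : M'.Indep A := ⟨hA, fun j => le_rfl⟩
  have hB' : M'.Indep B := ⟨hB, fun j => (hparts j).ge⟩
  have hcard : A.card = B.card := by
    have h : ∀ X ⊆ A ∪ B, X.card =
        ∑ j ∈ (A ∪ B).image part, (X.filter fun a => part a = j).card := fun X hX =>
      card_eq_sum_card_fiberwise fun x hx => mem_image_of_mem part (hX hx)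
    rw [h A subset_union_left, h B subset_union_right]
    exact sum_congr rfl fun j _ => hparts j
  have hcard' : (A \ B).card = (B \ A).card := by
    have h1 := card_sdiff_add_card A B
    have h2 := card_sdiff_add_card B A
    rw [union_comm B A] at h2
    omega
  have hpart : ∀ X : Finset α, (∀ j, (X.filter fun a => part a = j).card =
      (A.filter fun a => part a = j).card) → ∀ u v, v ∉ X →
      M'.Indep (insert v (X.erase u)) → part u = part v := by
    intro X hX u v hv hi
    by_contra hne
    have h := hi.2 (part v)
    have heq : ((insert v (X.erase u)).filter fun a => part a = part v) =
        insert v (X.filter fun a => part a = part v) := by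
      ext x
      simp only [mem_filter, mem_insert, mem_erase]
      constructor
      · tauto
      · rintro (rfl | h)
        · simp
        · exact ⟨Or.inr ⟨fun hxu => hne (hxu ▸ h.2), h.1⟩, h.2⟩
    rw [heq, card_insert_of_notMem (fun h => hv (mem_filter.1 h).1), hX] at h
    exact absurd h (Nat.not_succ_le_self _)
  have hdisj : Disjoint (A \ B) (B \ A) := disjoint_sdiff_sdiff
  have hconst : ∀ U V : Finset α, Disjoint U V → ∀ E : α → α → Prop, ∃ t : α → ℤ,
      ∀ u ∈ U, ∀ v ∈ V, E u v → (if gt v u then 1 else 0) ≤ t v - t u := by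
    intro U V hd E
    refine ⟨fun x => if x ∈ V then 1 else 0, fun u hu v hv _ => ?_⟩
    simp only [if_pos hv, if_neg (disjoint_left.1 hd hu)]
    split_ifs <;> simp
  have hweak := M'.card_sdiff_le_of_potentials gt hgt hA' hB' hcard
  obtain ⟨s₀, hs₀⟩ := hconst (B \ A) (A \ B) hdisj.symm
    fun v u => M'.Indep (insert u (B.erase v))
  obtain ⟨t, g, ht, hg, hgE⟩ := exists_tight_matching (A \ B) (B \ A) hdisj
    (fun u v => M'.Indep (insert v (A.erase u))) (fun u v => if gt v u then 1 else 0)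
    ((A \ B).card - (∑ u ∈ A \ B, s₀ u - ∑ v ∈ B \ A, s₀ v)) (hconst _ _ hdisj _)
    (fun t ht => by linarith [hweak t s₀ ht hs₀])
  obtain ⟨s, g', hs, hg', hgE'⟩ := exists_tight_matching (B \ A) (A \ B) hdisj.symm
    (fun v u => M'.Indep (insert u (B.erase v))) (fun v u => if gt u v then 1 else 0)
    ((A \ B).card - (∑ v ∈ B \ A, t v - ∑ u ∈ A \ B, t u)) (hconst _ _ hdisj.symm _)
    (fun s hs => by linarith [hweak t s ht hs])
  have him := image_eq_of_injOn_of_card_eq hcard' hg fun u hu => (hgE u hu).1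
  have him' := image_eq_of_injOn_of_card_eq hcard'.symm hg' fun u hu => (hgE' u hu).1
  refine ⟨_, _,
    feasible_of_augmentation M part hIA hAIJ hA hJB (union_comm J I ▸ hBJI) hB hBn' g hg him
      (fun u hu => (hgE u hu).2.1.1)
      (fun u hu => hpart A (fun _ => rfl) u (g u) (mem_sdiff.1 (hgE u hu).1).2 (hgE u hu).2.1),
    feasible_of_augmentation M part hJB hBJI hB hIA (union_comm I J ▸ hAIJ) hA hAn' g' hg' him'
      (fun u hu => (hgE' u hu).2.1.1)
      (fun u hu => hpart B (fun j => (hparts j).symm) u (g' u) (mem_sdiff.1 (hgE' u hu).1).2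
        (hgE' u hu).2.1), ?_⟩
  rw [voteN_image gt hgt _ _ _ _ fun u hu h => disjoint_left.1 hdisj hu (h ▸ (hgE u hu).1),
    voteN_image gt hgt _ _ _ _ fun u hu h => disjoint_left.1 hdisj (h ▸ (hgE' u hu).1) hu,
    sum_congr rfl fun u hu => (hgE u hu).2.2, sum_congr rfl fun u hu => (hgE' u hu).2.2,
    sum_sub_distrib, sum_sub_distrib, ← sum_image hg, ← sum_image hg', him, him', ← hcard']
  linarith [hweak t s ht hs]

lemma bddBelow_votes {α : Type*} [Fintype α] (gt : α → α → Prop)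
    (I J : Finset α) (P : Finset (α × α) → Prop) :
    BddBelow {z : ℤ | ∃ N : Finset (α × α), P N ∧ z = voteN gt I J N} := by
  refine ((Set.finite_range fun N => voteN gt I J N).subset ?_).bddBelow
  rintro z ⟨N, -, rfl⟩
  exact ⟨N, rfl⟩

lemma voteF_le {α ι : Type*} [DecidableEq α] [Fintype α] {M : FinMatroid α}
    {gt : α → α → Prop} {part : α → ι} {I J : Finset α} {N : Finset (α × α)}
    (hN : Feasible M part I J N) : voteF M gt part I J ≤ voteN gt I J N :=
  csInf_le (bddBelow_votes gt I J _) ⟨N, hN, rfl⟩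

lemma voteB_le_voteF {α ι : Type*} [DecidableEq α] [Fintype α] {M : FinMatroid α}
    {gt : α → α → Prop} {part : α → ι} {I J : Finset α} {N : Finset (α × α)}
    (hN : Feasible M part I J N) : voteB M gt I J ≤ voteF M gt part I J :=
  csInf_le_csInf (bddBelow_votes gt I J _) ⟨_, N, hN, rfl⟩
    fun _ ⟨K, hK, hz⟩ => ⟨K, hK.1, hz⟩

/-- for ordered matroids `M₁`, `M₂` on the same ground set, each presented as a
direct sum along partitions `part₁`, `part₂`, and a common independent set `I`:
super popular ⟹ popular ⟹ defendable ⟹ weakly defendable.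
(`gtᵢ a b` means `a ≻ᵢ b`.) -/
theorem stmt_4 {α ι₁ ι₂ : Type*} [DecidableEq α] [Fintype α]
    (M₁ M₂ : FinMatroid α) (gt₁ gt₂ : α → α → Prop)
    (h₁ : IsStrictTotalOrder α gt₁) (h₂ : IsStrictTotalOrder α gt₂)
    (part₁ : α → ι₁) (part₂ : α → ι₂)
    (hdsum₁ : ∀ X : Finset α, M₁.Indep X ↔ ∀ j : ι₁, M₁.Indep (X.filter fun a => part₁ a = j))
    (hdsum₂ : ∀ X : Finset α, M₂.Indep X ↔ ∀ j : ι₂, M₂.Indep (X.filter fun a => part₂ a = j))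
    (I : Finset α) (hI₁ : M₁.Indep I) (hI₂ : M₂.Indep I) :
    -- super popular → popular
    ((∀ J, M₁.Indep J → M₂.Indep J → 0 ≤ voteB M₁ gt₁ I J + voteB M₂ gt₂ I J) →
      (∀ J, M₁.Indep J → M₂.Indep J →
        0 ≤ voteF M₁ gt₁ part₁ I J + voteF M₂ gt₂ part₂ I J)) ∧
    -- popular → defendable
    ((∀ J, M₁.Indep J → M₂.Indep J →
        0 ≤ voteF M₁ gt₁ part₁ I J + voteF M₂ gt₂ part₂ I J) →
      (∀ J, M₁.Indep J → M₂.Indep J →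
        voteF M₁ gt₁ part₁ J I + voteF M₂ gt₂ part₂ J I ≤ 0)) ∧
    -- defendable → weakly defendable
    ((∀ J, M₁.Indep J → M₂.Indep J →
        voteF M₁ gt₁ part₁ J I + voteF M₂ gt₂ part₂ J I ≤ 0) →
      (∀ J, M₁.Indep J → M₂.Indep J →
        voteB M₁ gt₁ J I + voteB M₂ gt₂ J I ≤ 0)) := by
  refine ⟨fun h J hJ₁ hJ₂ => ?_, fun h J hJ₁ hJ₂ => ?_, fun h J hJ₁ hJ₂ => ?_⟩ <;>
  obtain ⟨N₁, N₁', hN₁, hN₁', hv₁⟩ := exists_feasible_pair M₁ gt₁ h₁ part₁ hdsum₁ hI₁ hJ₁ <;>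
  obtain ⟨N₂, N₂', hN₂, hN₂', hv₂⟩ := exists_feasible_pair M₂ gt₂ h₂ part₂ hdsum₂ hI₂ hJ₂ <;>
  specialize h J hJ₁ hJ₂
  · exact h.trans (add_le_add (voteB_le_voteF hN₁) (voteB_le_voteF hN₂))
  · linarith [voteF_le (gt := gt₁) hN₁, voteF_le (gt := gt₁) hN₁', voteF_le (gt := gt₂) hN₂,
      voteF_le (gt := gt₂) hN₂']
  · exact (add_le_add (voteB_le_voteF hN₁') (voteB_le_voteF hN₂')).trans h

end
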